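/- Let P be an m×m row-stochastic matrix and δ ≥ 1 an integer such that the limit Δ = lim_{k→∞} P^{δk} exists entrywise. Then there exist α > 0 and β > 0 such that for all integers s ≥ 1, ‖P^{δs} − Δ‖_∞ ≤ α e^{−βs}, where ‖·‖_∞ is the matrix norm induced by the sup-norm (maximum absolute row sum). -/

import Mathlib

set_option autoImplicit false

open Matrix Filter

attribute [local instance] Matrix.linftyOpNormedAddCommGroup

/-- In a normed ring, powers tending to zero do so exponentially fast. -/
theorem exists_norm_pow_le_mul_exp_of_tendsto_zero {R : Type*} [NormedRing R] {b : R}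
    (hb : Tendsto (fun k : ℕ => b ^ k) atTop (nhds 0)) :
    ∃ α β : ℝ, 0 < α ∧ 0 < β ∧ ∀ s : ℕ, ‖b ^ s‖ ≤ α * Real.exp (-β * s) := by
  obtain ⟨M, hM⟩ := (Metric.isBounded_range_of_tendsto _ hb).exists_norm_le
  replace hM : ∀ k : ℕ, ‖b ^ k‖ ≤ max M 1 :=
    fun k => (hM _ ⟨k, rfl⟩).trans (le_max_left _ _)
  have hM_pos : (0 : ℝ) < max M 1 := lt_max_of_lt_right one_pos
  have hev : ∀ᶠ k : ℕ in atTop, ‖b ^ k‖ < Real.exp (-1) :=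
    (tendsto_zero_iff_norm_tendsto_zero.mp hb).eventually_lt_const (Real.exp_pos _)
  obtain ⟨N, hN, hN_pos⟩ := (hev.and (eventually_ge_atTop 1)).exists
  have key : ∀ q r : ℕ, ‖b ^ (N * q + r)‖ ≤ max M 1 * Real.exp (-(q : ℝ)) := by
    intro q r
    induction q with
    | zero => simpa using hM r
    | succ q ih =>
      calc ‖b ^ (N * (q + 1) + r)‖ = ‖b ^ N * b ^ (N * q + r)‖ := by
            rw [← pow_add]; congr 2; ring
        _ ≤ ‖b ^ N‖ * ‖b ^ (N * q + r)‖ := norm_mul_le _ _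
        _ ≤ Real.exp (-1) * (max M 1 * Real.exp (-(q : ℝ))) := by gcongr
        _ = max M 1 * Real.exp (-((q + 1 : ℕ) : ℝ)) := by
            rw [mul_left_comm, ← Real.exp_add]; push_cast; congr 2; ring
  have hN_pos' : (0 : ℝ) < N := by exact_mod_cast hN_pos
  refine ⟨max M 1 * Real.exp 1, 1 / N, by positivity, by positivity, fun s => ?_⟩
  have hlt : (s : ℝ) < N * (s / N : ℕ) + N := by
    exact_mod_cast Nat.lt_mul_div_succ s hN_pos
  have hdiv : (s : ℝ) / N ≤ (s / N : ℕ) + 1 := by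
    rw [div_le_iff₀ hN_pos']; linarith
  calc ‖b ^ s‖ = ‖b ^ (N * (s / N) + s % N)‖ := by rw [Nat.div_add_mod]
    _ ≤ max M 1 * Real.exp (-((s / N : ℕ) : ℝ)) := key _ _
    _ ≤ max M 1 * Real.exp (1 + -(1 / N) * s) := by
        gcongr
        have : -(1 / (N : ℝ)) * s = -(s / N) := by ring
        linarith
    _ = max M 1 * Real.exp 1 * Real.exp (-(1 / N) * s) := by rw [Real.exp_add, mul_assoc]

/-- If the powers of `a` converge to `d`, then `a ^ k - d` is itself a power. -/
theorem sub_pow_succ_of_tendsto_pow {R : Type*} [Ring R] [TopologicalSpace R]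
    [T2Space R] [ContinuousMul R] {a d : R}
    (h : Tendsto (fun k : ℕ => a ^ k) atTop (nhds d)) (k : ℕ) :
    (a - d) ^ (k + 1) = a ^ (k + 1) - d := by
  have hs : Tendsto (fun k : ℕ => a ^ (k + 1)) atTop (nhds d) :=
    h.comp (tendsto_add_atTop_nat 1)
  have had : a * d = d :=
    tendsto_nhds_unique ((h.const_mul a).congr fun k => (pow_succ' a k).symm) hs
  have hda : d * a = d :=
    tendsto_nhds_unique ((h.mul_const a).congr fun k => (pow_succ a k).symm) hs
  have hpow : ∀ k : ℕ, a ^ k * d = d := by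
    intro k
    induction k with
    | zero => simp
    | succ k ih => rw [pow_succ, mul_assoc, had, ih]
  have hdd : d * d = d :=
    tendsto_nhds_unique (h.mul_const d) (tendsto_const_nhds.congr fun k => (hpow k).symm)
  induction k with
  | zero => simp
  | succ k ih => rw [pow_succ, ih, sub_mul, mul_sub, mul_sub, hpow, hda, hdd, ← pow_succ]; abel

/-- In a normed ring, convergent sequences of powers converge exponentially fast. -/
theorem exists_norm_pow_sub_le_mul_exp_of_tendsto {R : Type*} [NormedRing R] {a d : R}
    (h : Tendsto (fun k : ℕ => a ^ k) atTop (nhds d)) :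
    ∃ α β : ℝ, 0 < α ∧ 0 < β ∧
      ∀ s : ℕ, 1 ≤ s → ‖a ^ s - d‖ ≤ α * Real.exp (-β * s) := by
  have hb : Tendsto (fun k : ℕ => (a - d) ^ k) atTop (nhds 0) := by
    rw [← tendsto_add_atTop_iff_nat 1]
    simp_rw [sub_pow_succ_of_tendsto_pow h]
    simpa using (h.comp (tendsto_add_atTop_nat 1)).sub_const d
  obtain ⟨α, β, hα, hβ, hbound⟩ := exists_norm_pow_le_mul_exp_of_tendsto_zero hb
  refine ⟨α, β, hα, hβ, fun s hs => ?_⟩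
  obtain ⟨k, rfl⟩ := Nat.exists_eq_add_of_le' hs
  rw [← sub_pow_succ_of_tendsto_pow h]
  exact hbound _

/-- **Exponential convergence of matrix powers** (Lemma 4 (i)).
If `P` is row-stochastic and `P^{δk} → Δ` entrywise, then `‖P^{δs} − Δ‖_∞ ≤ α e^{−βs}`
for all `s ≥ 1`, where `‖·‖_∞` is the matrix norm induced by the sup-norm
(maximum absolute row sum). -/
theorem stmt_8 (m δ : ℕ) (hδ : 1 ≤ δ) (P : Matrix (Fin m) (Fin m) ℝ)
    (hP_nonneg : ∀ i j, 0 ≤ P i j) (hP_row : ∀ i, ∑ j, P i j = 1)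
    (Δ : Matrix (Fin m) (Fin m) ℝ)
    (hconv : Tendsto (fun k : ℕ => P ^ (δ * k)) atTop (nhds Δ)) :
    ∃ α β : ℝ, 0 < α ∧ 0 < β ∧
      ∀ s : ℕ, 1 ≤ s → ‖P ^ (δ * s) - Δ‖ ≤ α * Real.exp (-β * s) := by
  let : NormedRing (Matrix (Fin m) (Fin m) ℝ) := Matrix.linftyOpNormedRing
  simp only [pow_mul] at hconv ⊢
  exact exists_norm_pow_sub_le_mul_exp_of_tendsto hconv
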